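/- arXiv:2504.12804 — 4 statements merged into one kernel-verified Lean document; each statement's English description precedes it below -/
import Mathlib

section
/- Let A₁ and A₂ be Hermitian 2×2 complex matrices. Then either there exist real numbers t₁, t₂ such that t₁A₁ + t₂A₂ is positive definite or negative definite, or there exists a nonzero vector x ∈ ℂ² with x*A₁x = 0 and x*A₂x = 0. -/
open Matrix ComplexOrder

/-- The Hermitian matrix with coordinates `s, a, b, c` in the basis of Pauli matrices. -/
def pauliMatrix (s a b c : ℝ) : Matrix (Fin 2) (Fin 2) ℂ :=
  !![⟨s + c, 0⟩, ⟨a, -b⟩; ⟨a, b⟩, ⟨s - c, 0⟩]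

theorem Matrix.IsHermitian.exists_eq_pauliMatrix {A : Matrix (Fin 2) (Fin 2) ℂ}
    (h : A.IsHermitian) : ∃ s a b c : ℝ, A = pauliMatrix s a b c := by
  have h00 := congrArg Complex.im (h.apply 0 0)
  have h11 := congrArg Complex.im (h.apply 1 1)
  have h01 := h.apply 0 1
  simp only [RCLike.star_def, Complex.conj_im] at h00 h11
  refine ⟨((A 0 0).re + (A 1 1).re) / 2, (A 1 0).re, (A 1 0).im,
    ((A 0 0).re - (A 1 1).re) / 2, ?_⟩
  ext i j
  fin_cases i <;> fin_cases j <;> apply Complex.ext <;> simp [pauliMatrix, ← h01] <;> linarith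

theorem pauliMatrix_isHermitian (s a b c : ℝ) : (pauliMatrix s a b c).IsHermitian := by
  ext i j
  fin_cases i <;> fin_cases j <;> apply Complex.ext <;> simp [pauliMatrix]

theorem smul_pauliMatrix_add_smul (t₁ t₂ s₁ a₁ b₁ c₁ s₂ a₂ b₂ c₂ : ℝ) :
    t₁ • pauliMatrix s₁ a₁ b₁ c₁ + t₂ • pauliMatrix s₂ a₂ b₂ c₂ =
      pauliMatrix (t₁ * s₁ + t₂ * s₂) (t₁ * a₁ + t₂ * a₂) (t₁ * b₁ + t₂ * b₂)
        (t₁ * c₁ + t₂ * c₂) := by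
  ext i j
  fin_cases i <;> fin_cases j <;> apply Complex.ext <;> simp [pauliMatrix] <;> ring

theorem neg_pauliMatrix (s a b c : ℝ) :
    -pauliMatrix s a b c = pauliMatrix (-s) (-a) (-b) (-c) := by
  ext i j
  fin_cases i <;> fin_cases j <;> apply Complex.ext <;> simp [pauliMatrix] <;> ring

theorem star_dotProduct_pauliMatrix_mulVec (s a b c : ℝ) (x : Fin 2 → ℂ) :
    star x ⬝ᵥ (pauliMatrix s a b c).mulVec x =
      (((s + c) * ((x 0).re ^ 2 + (x 0).im ^ 2) + (s - c) * ((x 1).re ^ 2 + (x 1).im ^ 2) +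
        2 * (a * ((x 0).re * (x 1).re + (x 0).im * (x 1).im) +
          b * ((x 0).re * (x 1).im - (x 0).im * (x 1).re)) : ℝ) : ℂ) := by
  apply Complex.ext
  · simp [pauliMatrix, dotProduct, mulVec, Fin.sum_univ_two, -Complex.ofReal_add,
      -Complex.ofReal_mul]
    ring
  · simp only [Complex.ofReal_im]
    simp [pauliMatrix, dotProduct, mulVec, Fin.sum_univ_two]
    ring

theorem pauliMatrix_posDef {s a b c : ℝ} (hs : 0 < s) (h : a ^ 2 + b ^ 2 + c ^ 2 < s ^ 2) :
    (pauliMatrix s a b c).PosDef := by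
  refine .of_dotProduct_mulVec_pos (pauliMatrix_isHermitian s a b c) fun x hx ↦ ?_
  rw [star_dotProduct_pauliMatrix_mulVec]
  norm_cast
  have hsc : 0 < s + c := by nlinarith [sq_nonneg a, sq_nonneg b]
  have hdet : 0 < s ^ 2 - (a ^ 2 + b ^ 2 + c ^ 2) := sub_pos.2 h
  generalize hp : (x 0).re = p
  generalize hq : (x 0).im = q
  generalize hr : (x 1).re = r
  generalize ht : (x 1).im = t
  refine pos_of_mul_pos_right (a := s + c) ?_ hsc.le
  have key : (s + c) * ((s + c) * (p ^ 2 + q ^ 2) + (s - c) * (r ^ 2 + t ^ 2) +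
      2 * (a * (p * r + q * t) + b * (p * t - q * r))) =
      ((s + c) * p + a * r + b * t) ^ 2 + ((s + c) * q + a * t - b * r) ^ 2 +
        (s ^ 2 - (a ^ 2 + b ^ 2 + c ^ 2)) * (r ^ 2 + t ^ 2) := by ring
  rw [key]
  by_cases h1 : r ^ 2 + t ^ 2 = 0
  · have hr0 : r = 0 := by nlinarith [sq_nonneg r, sq_nonneg t]
    have ht0 : t = 0 := by nlinarith [sq_nonneg r, sq_nonneg t]
    have hpq : p ^ 2 + q ^ 2 ≠ 0 := fun h0 ↦ hx <| by
      have hp0 : p = 0 := by nlinarith [sq_nonneg p, sq_nonneg q]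
      have hq0 : q = 0 := by nlinarith [sq_nonneg p, sq_nonneg q]
      ext i
      fin_cases i <;> apply Complex.ext <;> simp [*]
    have : 0 < p ^ 2 + q ^ 2 := lt_of_le_of_ne (by positivity) hpq.symm
    have := mul_pos (pow_pos hsc 2) this
    subst hr0 ht0
    nlinarith
  · have : 0 < r ^ 2 + t ^ 2 := lt_of_le_of_ne (by positivity) (Ne.symm h1)
    positivity

theorem pauliMatrix_posDef_or_neg_posDef {s a b c : ℝ} (h : a ^ 2 + b ^ 2 + c ^ 2 < s ^ 2) :
    (pauliMatrix s a b c).PosDef ∨ (-pauliMatrix s a b c).PosDef := by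
  have hs0 : s ≠ 0 := by
    rintro rfl
    nlinarith [sq_nonneg a, sq_nonneg b, sq_nonneg c]
  rcases hs0.lt_or_gt with hs | hs
  · right
    rw [neg_pauliMatrix]
    exact pauliMatrix_posDef (neg_pos.2 hs) (by simpa using h)
  · exact .inl (pauliMatrix_posDef hs h)

/-- A unit vector `(u, v, w)` is the Bloch vector of some nonzero `x`. -/
theorem exists_forall_pauliMatrix_eq_zero {u v w : ℝ} (h : u ^ 2 + v ^ 2 + w ^ 2 = 1) :
    ∃ x : Fin 2 → ℂ, x ≠ 0 ∧ ∀ s a b c : ℝ, s + (a * u + b * v + c * w) = 0 →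
      star x ⬝ᵥ (pauliMatrix s a b c).mulVec x = 0 := by
  by_cases hw : 1 + w = 0
  · obtain rfl : w = -1 := by linarith
    have hu : u = 0 := by nlinarith [sq_nonneg u, sq_nonneg v]
    have hv : v = 0 := by nlinarith [sq_nonneg u, sq_nonneg v]
    subst hu hv
    refine ⟨![0, 1], fun h0 ↦ by simpa using congrFun h0 1, fun s a b c h0 ↦ ?_⟩
    rw [star_dotProduct_pauliMatrix_mulVec, Complex.ofReal_eq_zero]
    simp
    linarith
  · refine ⟨![⟨1 + w, 0⟩, ⟨u, v⟩], fun h0 ↦ hw ?_, fun s a b c h0 ↦ ?_⟩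
    · simpa using congrArg Complex.re (congrFun h0 0)
    · rw [star_dotProduct_pauliMatrix_mulVec, Complex.ofReal_eq_zero]
      simp
      linear_combination 2 * (1 + w) * h0 + (s - c) * h

theorem exists_add_smul_unit {p q r n₁ n₂ n₃ : ℝ} (hle : p ^ 2 + q ^ 2 + r ^ 2 ≤ 1)
    (hort : p * n₁ + q * n₂ + r * n₃ = 0) (hn : 0 < n₁ ^ 2 + n₂ ^ 2 + n₃ ^ 2) :
    ∃ g : ℝ, (p + g * n₁) ^ 2 + (q + g * n₂) ^ 2 + (r + g * n₃) ^ 2 = 1 := by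
  refine ⟨√((1 - (p ^ 2 + q ^ 2 + r ^ 2)) / (n₁ ^ 2 + n₂ ^ 2 + n₃ ^ 2)), ?_⟩
  have hsq := Real.sq_sqrt (div_nonneg (sub_nonneg.2 hle) hn.le)
  generalize √((1 - (p ^ 2 + q ^ 2 + r ^ 2)) / (n₁ ^ 2 + n₂ ^ 2 + n₃ ^ 2)) = g at hsq
  rw [eq_div_iff hn.ne'] at hsq
  linear_combination hsq + 2 * g * hort

theorem exists_orthogonal_ne_zero (a b c : ℝ) :
    ∃ n₁ n₂ n₃ : ℝ, a * n₁ + b * n₂ + c * n₃ = 0 ∧ 0 < n₁ ^ 2 + n₂ ^ 2 + n₃ ^ 2 := by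
  by_cases h : a ^ 2 + b ^ 2 = 0
  · have ha : a = 0 := by nlinarith [sq_nonneg a, sq_nonneg b]
    exact ⟨1, 0, 0, by simp [ha], by norm_num⟩
  · have : 0 < a ^ 2 + b ^ 2 := lt_of_le_of_ne (by positivity) (Ne.symm h)
    exact ⟨-b, a, 0, by ring, by linarith⟩

theorem exists_unit_dot_eq_neg {s a b c : ℝ} (h : s ^ 2 ≤ a ^ 2 + b ^ 2 + c ^ 2) :
    ∃ u v w : ℝ, u ^ 2 + v ^ 2 + w ^ 2 = 1 ∧ s + (a * u + b * v + c * w) = 0 := by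
  obtain ⟨n₁, n₂, n₃, hort, hn⟩ := exists_orthogonal_ne_zero a b c
  have hK : ∃ l : ℝ, s + l * (a ^ 2 + b ^ 2 + c ^ 2) = 0 ∧
      l ^ 2 * (a ^ 2 + b ^ 2 + c ^ 2) ≤ 1 := by
    rcases (by positivity : 0 ≤ a ^ 2 + b ^ 2 + c ^ 2).eq_or_lt' with h0 | h0
    · rw [h0] at h ⊢
      exact ⟨0, by nlinarith, by norm_num⟩
    · refine ⟨-s / (a ^ 2 + b ^ 2 + c ^ 2), by field_simp; ring, ?_⟩
      rw [div_pow, neg_sq, div_mul_eq_mul_div, div_le_one (by positivity)]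
      nlinarith
  obtain ⟨l, hl, hl1⟩ := hK
  obtain ⟨g, hg⟩ := exists_add_smul_unit (p := l * a) (q := l * b) (r := l * c)
    (by linarith) (by linear_combination l * hort) hn
  exact ⟨_, _, _, hg, by linear_combination hl + g * hort⟩

theorem exists_unit_dot_eq_neg_pair {s₁ a₁ b₁ c₁ s₂ a₂ b₂ c₂ : ℝ}
    (h : ∀ t₁ t₂ : ℝ, (t₁ * s₁ + t₂ * s₂) ^ 2 ≤
      (t₁ * a₁ + t₂ * a₂) ^ 2 + (t₁ * b₁ + t₂ * b₂) ^ 2 + (t₁ * c₁ + t₂ * c₂) ^ 2) :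
    ∃ u v w : ℝ, u ^ 2 + v ^ 2 + w ^ 2 = 1 ∧ s₁ + (a₁ * u + b₁ * v + c₁ * w) = 0 ∧
      s₂ + (a₂ * u + b₂ * v + c₂ * w) = 0 := by
  rcases (by positivity : 0 ≤ (b₁ * c₂ - c₁ * b₂) ^ 2 + (c₁ * a₂ - a₁ * c₂) ^ 2 +
    (a₁ * b₂ - b₁ * a₂) ^ 2).eq_or_lt' with hn | hn
  · have hx : b₁ * c₂ - c₁ * b₂ = 0 := by
      refine pow_eq_zero_iff two_ne_zero |>.1 ?_
      nlinarith [sq_nonneg (b₁ * c₂ - c₁ * b₂), sq_nonneg (c₁ * a₂ - a₁ * c₂),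
        sq_nonneg (a₁ * b₂ - b₁ * a₂)]
    have hy : c₁ * a₂ - a₁ * c₂ = 0 := by
      refine pow_eq_zero_iff two_ne_zero |>.1 ?_
      nlinarith [sq_nonneg (b₁ * c₂ - c₁ * b₂), sq_nonneg (c₁ * a₂ - a₁ * c₂),
        sq_nonneg (a₁ * b₂ - b₁ * a₂)]
    have hz : a₁ * b₂ - b₁ * a₂ = 0 := by
      refine pow_eq_zero_iff two_ne_zero |>.1 ?_
      nlinarith [sq_nonneg (b₁ * c₂ - c₁ * b₂), sq_nonneg (c₁ * a₂ - a₁ * c₂),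
        sq_nonneg (a₁ * b₂ - b₁ * a₂)]
    rcases (by positivity : 0 ≤ a₁ ^ 2 + b₁ ^ 2 + c₁ ^ 2).eq_or_lt' with h0 | h0
    · have ha : a₁ = 0 := by nlinarith [sq_nonneg a₁, sq_nonneg b₁, sq_nonneg c₁]
      have hb : b₁ = 0 := by nlinarith [sq_nonneg a₁, sq_nonneg b₁, sq_nonneg c₁]
      have hc : c₁ = 0 := by nlinarith [sq_nonneg a₁, sq_nonneg b₁, sq_nonneg c₁]
      subst ha hb hc
      have hs : s₁ = 0 := by nlinarith [h 1 0]
      obtain ⟨u, v, w, h1, h2⟩ := exists_unit_dot_eq_neg (s := s₂) (a := a₂) (b := b₂) (c := c₂)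
        (by simpa using h 0 1)
      exact ⟨u, v, w, h1, by simp [hs], h2⟩
    · obtain ⟨u, v, w, h1, h2⟩ := exists_unit_dot_eq_neg (s := s₁) (a := a₁) (b := b₁) (c := c₁)
        (by simpa using h 1 0)
      obtain ⟨l, hl⟩ : ∃ l, l * (a₁ ^ 2 + b₁ ^ 2 + c₁ ^ 2) = a₁ * a₂ + b₁ * b₂ + c₁ * c₂ :=
        ⟨_, div_mul_cancel₀ _ h0.ne'⟩
      have ha : a₂ = l * a₁ := mul_right_cancel₀ h0.ne' <| by
        linear_combination -a₁ * hl - b₁ * hz + c₁ * hy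
      have hb : b₂ = l * b₁ := mul_right_cancel₀ h0.ne' <| by
        linear_combination -b₁ * hl - c₁ * hx + a₁ * hz
      have hc : c₂ = l * c₁ := mul_right_cancel₀ h0.ne' <| by
        linear_combination -c₁ * hl - a₁ * hy + b₁ * hx
      subst ha hb hc
      have hs : l * s₁ - s₂ = 0 := by
        refine pow_eq_zero_iff two_ne_zero |>.1 (le_antisymm ?_ (sq_nonneg _))
        linear_combination h l (-1)
      exact ⟨u, v, w, h1, h2, by linear_combination l * h2 - hs⟩
  · set D := (b₁ * c₂ - c₁ * b₂) ^ 2 + (c₁ * a₂ - a₁ * c₂) ^ 2 + (a₁ * b₂ - b₁ * a₂) ^ 2 with hD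
    obtain ⟨α, hα⟩ : ∃ α, α * D = s₁ * (a₂ ^ 2 + b₂ ^ 2 + c₂ ^ 2) -
        s₂ * (a₁ * a₂ + b₁ * b₂ + c₁ * c₂) := ⟨_, div_mul_cancel₀ _ hn.ne'⟩
    obtain ⟨β, hβ⟩ : ∃ β, β * D = s₂ * (a₁ ^ 2 + b₁ ^ 2 + c₁ ^ 2) -
        s₁ * (a₁ * a₂ + b₁ * b₂ + c₁ * c₂) := ⟨_, div_mul_cancel₀ _ hn.ne'⟩
    have e₁ : α * (a₁ ^ 2 + b₁ ^ 2 + c₁ ^ 2) + β * (a₁ * a₂ + b₁ * b₂ + c₁ * c₂) = s₁ :=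
      mul_right_cancel₀ hn.ne' <| by
        linear_combination (a₁ ^ 2 + b₁ ^ 2 + c₁ ^ 2) * hα +
          (a₁ * a₂ + b₁ * b₂ + c₁ * c₂) * hβ - s₁ * hD
    have e₂ : α * (a₁ * a₂ + b₁ * b₂ + c₁ * c₂) + β * (a₂ ^ 2 + b₂ ^ 2 + c₂ ^ 2) = s₂ :=
      mul_right_cancel₀ hn.ne' <| by
        linear_combination (a₁ * a₂ + b₁ * b₂ + c₁ * c₂) * hα +
          (a₂ ^ 2 + b₂ ^ 2 + c₂ ^ 2) * hβ - s₂ * hD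
    have hw : (α * a₁ + β * a₂) ^ 2 + (α * b₁ + β * b₂) ^ 2 + (α * c₁ + β * c₂) ^ 2 =
        α * s₁ + β * s₂ := by linear_combination α * e₁ + β * e₂
    have hle : α * s₁ + β * s₂ ≤ 1 := by
      have := h α β
      rw [hw] at this
      nlinarith
    obtain ⟨g, hg⟩ := exists_add_smul_unit (p := -(α * a₁ + β * a₂)) (q := -(α * b₁ + β * b₂))
      (r := -(α * c₁ + β * c₂)) (by linarith) (by ring) hn
    exact ⟨_, _, _, hg, by linear_combination -e₁, by linear_combination -e₂⟩

theorem stmt8 (A₁ A₂ : Matrix (Fin 2) (Fin 2) ℂ)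
    (h₁ : A₁.IsHermitian) (h₂ : A₂.IsHermitian) :
    (∃ t₁ t₂ : ℝ,
        (t₁ • A₁ + t₂ • A₂).PosDef ∨ (-(t₁ • A₁ + t₂ • A₂)).PosDef) ∨
    (∃ x : Fin 2 → ℂ, x ≠ 0 ∧
        star x ⬝ᵥ A₁.mulVec x = 0 ∧ star x ⬝ᵥ A₂.mulVec x = 0) := by
  obtain ⟨s₁, a₁, b₁, c₁, rfl⟩ := h₁.exists_eq_pauliMatrix
  obtain ⟨s₂, a₂, b₂, c₂, rfl⟩ := h₂.exists_eq_pauliMatrix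
  refine or_iff_not_imp_left.2 fun hdef ↦ ?_
  obtain ⟨u, v, w, hu, e₁, e₂⟩ := exists_unit_dot_eq_neg_pair
    (s₁ := s₁) (a₁ := a₁) (b₁ := b₁) (c₁ := c₁) (s₂ := s₂) (a₂ := a₂) (b₂ := b₂) (c₂ := c₂)
    fun t₁ t₂ ↦ not_lt.1 fun hlt ↦ hdef ⟨t₁, t₂, by
      rw [smul_pauliMatrix_add_smul]
      exact pauliMatrix_posDef_or_neg_posDef hlt⟩
  obtain ⟨x, hx, hx0⟩ := exists_forall_pauliMatrix_eq_zero hu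
  exact ⟨x, hx, hx0 _ _ _ _ e₁, hx0 _ _ _ _ e₂⟩
end

section
/- Let m ≥ 1 and let A₁, …, A_m be real symmetric 2×2 matrices, regarded as Hermitian forms on ℂ². Then either there exist real numbers c₁, …, c_m such that c₁A₁ + ⋯ + c_mA_m is positive definite, or there exists a nonzero vector x ∈ ℂ² with x*A_kx = 0 for every k = 1, …, m. -/
open Matrix ComplexOrder

/-- The value of a real symmetric binary form on `ℂ²`, in terms of the Stokes-type parameters
`|z|² + |w|²`, `|z|² - |w|²` and `2 Re (z̄ w)`. -/
theorem star_dotProduct_mulVec_fin_two_of_real {M : Matrix (Fin 2) (Fin 2) ℂ}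
    (hreal : ∀ i j, (M i j).im = 0) (hsymm : M.IsSymm) (x : Fin 2 → ℂ) :
    star x ⬝ᵥ M.mulVec x =
      (((M 0 0).re + (M 1 1).re) / 2 * (Complex.normSq (x 0) + Complex.normSq (x 1)) +
        (((M 0 0).re - (M 1 1).re) / 2 * (Complex.normSq (x 0) - Complex.normSq (x 1)) +
        (M 0 1).re * (2 * ((x 0).re * (x 1).re + (x 0).im * (x 1).im))) : ℝ) := by
  have h : M 1 0 = M 0 1 := hsymm.apply 0 1
  apply Complex.ext
  · simp [dotProduct, mulVec, Fin.sum_univ_two, h, hreal, Complex.normSq_apply]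
    ring
  · rw [Complex.ofReal_im]
    simp [dotProduct, mulVec, Fin.sum_univ_two, h, hreal]
    ring

/-- Every point of the closed unit disc is the parameter of some unit vector of `ℂ²`. -/
theorem exists_normSq_sub_eq_of_sq_add_sq_le_one {s b : ℝ} (h : s ^ 2 + b ^ 2 ≤ 1) :
    ∃ x : Fin 2 → ℂ, Complex.normSq (x 0) + Complex.normSq (x 1) = 1 ∧
      Complex.normSq (x 0) - Complex.normSq (x 1) = s ∧
      2 * ((x 0).re * (x 1).re + (x 0).im * (x 1).im) = b := by
  have hs : -1 ≤ s := by nlinarith [sq_nonneg b]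
  rcases hs.eq_or_lt with rfl | hs
  · have hb : b = 0 := by nlinarith [sq_nonneg b]
    exact ⟨![0, 1], by simp, by simp, by simp [hb]⟩
  · have hpos : 0 < (1 + s) / 2 := by linarith
    have hz := Real.sqrt_pos.2 hpos
    have hzz := Real.mul_self_sqrt hpos.le
    set z := √((1 + s) / 2)
    have hsq : b / (2 * z) * (b / (2 * z)) = b ^ 2 / (2 * (1 + s)) := by
      rw [div_mul_div_comm, show 2 * z * (2 * z) = 2 * (1 + s) by linear_combination 4 * hzz]
      ring
    have hle : 0 ≤ (1 - s) / 2 - b / (2 * z) * (b / (2 * z)) := by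
      rw [hsq, sub_nonneg, div_le_iff₀ (by linarith)]
      linarith
    have ht := Real.mul_self_sqrt hle
    refine ⟨![z, ⟨b / (2 * z), √((1 - s) / 2 - b / (2 * z) * (b / (2 * z)))⟩], ?_, ?_, ?_⟩
    · simp only [cons_val_zero, cons_val_one, Complex.normSq_apply, Complex.ofReal_re,
        Complex.ofReal_im]
      linarith
    · simp only [cons_val_zero, cons_val_one, Complex.normSq_apply, Complex.ofReal_re,
        Complex.ofReal_im]
      linarith
    · simp only [cons_val_zero, cons_val_one, Complex.ofReal_re, Complex.ofReal_im]
      field_simp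
      ring

/-- A finite family of real affine functions on the closed unit disc either has a common zero
there, or has a linear combination that is positive on the whole disc. -/
theorem exists_sum_pos_or_exists_common_zero_unit_disc {ι : Type*} [Fintype ι] (p q r : ι → ℝ) :
    (∃ c : ι → ℝ, ∀ s b : ℝ, s ^ 2 + b ^ 2 ≤ 1 → 0 < ∑ k, c k * (p k + (q k * s + r k * b))) ∨
    ∃ s b : ℝ, s ^ 2 + b ^ 2 ≤ 1 ∧ ∀ k, p k + (q k * s + r k * b) = 0 := by
  classical
  let G : ℂ →ₗ[ℝ] (ι → ℝ) :=
    Complex.reLm.smulRight q + Complex.imLm.smulRight r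
  have hG (u : ℂ) (k : ι) : G u k = q k * u.re + r k * u.im := by
    simp [G, mul_comm]
  have hball (u : ℂ) : u ∈ Metric.closedBall (0 : ℂ) 1 ↔ u.re ^ 2 + u.im ^ 2 ≤ 1 := by
    rw [mem_closedBall_zero_iff, ← sq_le_one_iff₀ (norm_nonneg u), Complex.sq_norm,
      Complex.normSq_apply, sq, sq]
  by_cases hp : -p ∈ G '' Metric.closedBall 0 1
  · obtain ⟨u, hu, hup⟩ := hp
    refine Or.inr ⟨u.re, u.im, (hball u).1 hu, fun k ↦ ?_⟩
    rw [← hG, hup, Pi.neg_apply, add_neg_cancel]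
  · left
    have hclosed : IsClosed (G '' Metric.closedBall 0 1) :=
      ((isCompact_closedBall (0 : ℂ) 1).image G.continuous_of_finiteDimensional).isClosed
    obtain ⟨f, v, hv, hf⟩ := geometric_hahn_banach_point_closed
      ((convex_closedBall (0 : ℂ) 1).linear_image G) hclosed hp
    refine ⟨fun k ↦ f (Pi.single k 1), fun s b h ↦ ?_⟩
    have hlt := hf _ ⟨⟨s, b⟩, (hball _).2 h, rfl⟩
    have hpos : 0 < f (p + G ⟨s, b⟩) := by
      rw [map_add]
      rw [map_neg] at hv
      linarith
    rw [pi_eq_sum_univ' (p + G ⟨s, b⟩), map_sum] at hpos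
    convert hpos using 2 with k
    rw [map_smul, Pi.add_apply, hG, smul_eq_mul, mul_comm]

theorem stmt9 (m : ℕ) (hm : 1 ≤ m) (A : Fin m → Matrix (Fin 2) (Fin 2) ℂ)
    (hreal : ∀ k i j, ((A k) i j).im = 0) (hsymm : ∀ k, (A k).IsSymm) :
    (∃ c : Fin m → ℝ, (∑ k, c k • A k).PosDef) ∨
    (∃ x : Fin 2 → ℂ, x ≠ 0 ∧ ∀ k, star x ⬝ᵥ (A k).mulVec x = 0) := by
  rcases exists_sum_pos_or_exists_common_zero_unit_disc
    (fun k ↦ ((A k 0 0).re + (A k 1 1).re) / 2) (fun k ↦ ((A k 0 0).re - (A k 1 1).re) / 2)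
    (fun k ↦ (A k 0 1).re) with ⟨c, hc⟩ | ⟨s, b, hsb, hzero⟩
  · refine Or.inl ⟨c, ?_⟩
    have hermitian (k : Fin m) : (A k).IsHermitian := by
      ext i j
      rw [conjTranspose_apply, (hsymm k).apply, Complex.star_def, Complex.conj_eq_iff_im]
      exact hreal k i j
    refine PosDef.of_dotProduct_mulVec_pos ?_ fun x hx ↦ ?_
    · rw [IsHermitian, conjTranspose_sum]
      refine Finset.sum_congr rfl fun k _ ↦ ?_
      rw [conjTranspose_smul, (hermitian k).eq, star_trivial]
    · have hn : 0 < Complex.normSq (x 0) + Complex.normSq (x 1) := by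
        have h0 := Complex.normSq_nonneg (x 0)
        have h1 := Complex.normSq_nonneg (x 1)
        refine (add_nonneg h0 h1).lt_of_ne' fun h ↦ hx ?_
        have hx0 : x 0 = 0 := Complex.normSq_eq_zero.1 (by linarith)
        have hx1 : x 1 = 0 := Complex.normSq_eq_zero.1 (by linarith)
        exact funext (Fin.forall_fin_two.2 ⟨hx0, hx1⟩)
      simp only [sum_mulVec, dotProduct_sum, smul_mulVec, dotProduct_smul,
        star_dotProduct_mulVec_fin_two_of_real (hreal _) (hsymm _), Complex.real_smul,
        ← Complex.ofReal_mul, ← Complex.ofReal_sum, Complex.zero_lt_real]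
      set n := Complex.normSq (x 0) + Complex.normSq (x 1) with hn_def
      set s := Complex.normSq (x 0) - Complex.normSq (x 1) with hs_def
      set b := 2 * ((x 0).re * (x 1).re + (x 0).im * (x 1).im) with hb_def
      have hle : s ^ 2 + b ^ 2 ≤ n ^ 2 := by
        rw [hn_def, hs_def, hb_def]
        simp only [Complex.normSq_apply]
        nlinarith [sq_nonneg ((x 0).re * (x 1).im - (x 0).im * (x 1).re)]
      have key := hc (s / n) (b / n) (by
        rwa [div_pow, div_pow, ← add_div, div_le_one (by positivity)])
      refine (mul_pos hn key).trans_eq ?_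
      rw [Finset.mul_sum]
      refine Finset.sum_congr rfl fun k _ ↦ ?_
      field_simp
  · obtain ⟨x, hn, hs, hb⟩ := exists_normSq_sub_eq_of_sq_add_sq_le_one hsb
    refine Or.inr ⟨x, ?_, fun k ↦ ?_⟩
    · rintro rfl
      simp at hn
    · rw [star_dotProduct_mulVec_fin_two_of_real (hreal k) (hsymm k), hn, hs, hb, mul_one,
        hzero k, Complex.ofReal_zero]
end

section
/- Let A₁ = [[1,0,0],[0,−1,0],[0,0,0]], A₂ = [[0,1,0],[1,0,0],[0,0,0]], A₃ = [[0,0,1],[0,0,0],[1,0,0]], A₄ = [[0,0,0],[0,0,1],[0,1,0]], A₅ = [[0,0,0],[0,1,0],[0,0,−1]] (real symmetric 3×3 matrices, regarded as Hermitian forms on ℂ³). Then: (a) for every (c₁,…,c₅) ∈ ℝ⁵ the matrix c₁A₁ + ⋯ + c₅A₅ is neither positive definite nor negative definite on ℂ³; and (b) the only vector x ∈ ℂ³ satisfying x*A_kx = 0 for all k = 1,…,5 is x = 0. -/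
open Matrix ComplexOrder

noncomputable def A₁ : Matrix (Fin 3) (Fin 3) ℂ := !![1, 0, 0; 0, -1, 0; 0, 0, 0]
noncomputable def A₂ : Matrix (Fin 3) (Fin 3) ℂ := !![0, 1, 0; 1, 0, 0; 0, 0, 0]
noncomputable def A₃ : Matrix (Fin 3) (Fin 3) ℂ := !![0, 0, 1; 0, 0, 0; 1, 0, 0]
noncomputable def A₄ : Matrix (Fin 3) (Fin 3) ℂ := !![0, 0, 0; 0, 0, 1; 0, 1, 0]
noncomputable def A₅ : Matrix (Fin 3) (Fin 3) ℂ := !![0, 0, 0; 0, 1, 0; 0, 0, -1]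

/-- Three complex numbers of equal modulus that are pairwise orthogonal in the real plane vanish. -/
theorem eq_zero_of_pairwise_orthogonal {a b c : ℂ}
    (hab : star a * a = star b * b) (hbc : star b * b = star c * c)
    (oab : star a * b + star b * a = 0) (oac : star a * c + star c * a = 0)
    (obc : star b * c + star c * b = 0) : a = 0 ∧ b = 0 ∧ c = 0 := by
  have hprod : (star a * a) * (star b * b) * (star c * c) = 0 := by
    linear_combination (1 / 2 : ℂ) * (star b * c * (star c * a)) * oab
      - (1 / 2 : ℂ) * (star b * a * (star c * a)) * obc
      + (1 / 2 : ℂ) * (star b * a * (star c * b)) * oac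
  rw [← hbc, ← hab] at hprod
  have ha : star a * a = 0 := by simpa using hprod
  have hb : star b * b = 0 := hab ▸ ha
  have hc : star c * c = 0 := hbc ▸ hb
  simpa using And.intro ha (And.intro hb hc)

theorem stmt11 :
    (∀ c₁ c₂ c₃ c₄ c₅ : ℝ,
      ¬ (c₁ • A₁ + c₂ • A₂ + c₃ • A₃ + c₄ • A₄ + c₅ • A₅).PosDef ∧
      ¬ (-(c₁ • A₁ + c₂ • A₂ + c₃ • A₃ + c₄ • A₄ + c₅ • A₅)).PosDef) ∧
    (∀ x : Fin 3 → ℂ,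
      star x ⬝ᵥ A₁.mulVec x = 0 → star x ⬝ᵥ A₂.mulVec x = 0 →
      star x ⬝ᵥ A₃.mulVec x = 0 → star x ⬝ᵥ A₄.mulVec x = 0 →
      star x ⬝ᵥ A₅.mulVec x = 0 → x = 0) := by
  refine ⟨fun c₁ c₂ c₃ c₄ c₅ => ?_, fun x h₁ h₂ h₃ h₄ h₅ => ?_⟩
  · have htr : (c₁ • A₁ + c₂ • A₂ + c₃ • A₃ + c₄ • A₄ + c₅ • A₅).trace = 0 := by
      simp [Matrix.trace, Fin.sum_univ_three, A₁, A₂, A₃, A₄, A₅]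
    refine ⟨fun h => h.trace_pos.ne' htr, fun h => h.trace_pos.ne' ?_⟩
    rw [Matrix.trace_neg, htr, neg_zero]
  · simp only [dotProduct, Matrix.mulVec, Fin.sum_univ_three, A₁, A₂, A₃, A₄, A₅, Pi.star_apply,
      Matrix.of_apply, Matrix.cons_val] at h₁ h₂ h₃ h₄ h₅
    obtain ⟨h0, h1, h2⟩ := eq_zero_of_pairwise_orthogonal (a := x 0) (b := x 1) (c := x 2)
      (by linear_combination h₁) (by linear_combination h₅) (by linear_combination h₂)
      (by linear_combination h₃) (by linear_combination h₄)
    ext i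
    fin_cases i <;> simp [h0, h1, h2]
end

section
/- Let R and L be the 4×2 complex matrices R = (1/2)·[[1,0],[1,1],[1,i],[1,−i−1]] and L = (1/2)·[[0,1],[1,−1],[1,−i],[1−i,1]]. Then for every diagonal 4×4 matrix S with positive real diagonal entries, the trace of the 2×2 matrix (L* S² L)·(R* S⁻² R) is a real number and is greater than or equal to 2. -/
open Matrix

noncomputable def Rmat : Matrix (Fin 4) (Fin 2) ℂ :=
  (1 / 2 : ℂ) • !![1, 0; 1, 1; 1, Complex.I; 1, -Complex.I - 1]

noncomputable def Lmat : Matrix (Fin 4) (Fin 2) ℂ :=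
  (1 / 2 : ℂ) • !![0, 1; 1, -1; 1, -Complex.I; 1 - Complex.I, 1]

/-- The trace is a weighted sum of the symmetrized ratios of the squared diagonal entries. -/
theorem trace_eq_ofReal_sum_ratios (s : Fin 4 → ℝ) :
    ((Lmatᴴ * diagonal (fun i => ((s i : ℂ)) ^ 2) * Lmat)
      * (Rmatᴴ * diagonal (fun i => ((((s i) ^ 2)⁻¹ : ℝ) : ℂ)) * Rmat)).trace =
    (((1 / 16 : ℝ) * (
      (s 0 ^ 2 / s 1 ^ 2 + s 1 ^ 2 / s 0 ^ 2)
      + (s 0 ^ 2 / s 2 ^ 2 + s 2 ^ 2 / s 0 ^ 2)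
      + 2 * (s 0 ^ 2 / s 3 ^ 2 + s 3 ^ 2 / s 0 ^ 2)
      + 2 * (s 1 ^ 2 / s 2 ^ 2 + s 2 ^ 2 / s 1 ^ 2)
      + 5 * (s 1 ^ 2 / s 3 ^ 2 + s 3 ^ 2 / s 1 ^ 2)
      + 5 * (s 2 ^ 2 / s 3 ^ 2 + s 3 ^ 2 / s 2 ^ 2)) : ℝ) : ℂ) := by
  simp only [Lmat, Rmat, trace_fin_two, mul_apply, Fin.sum_univ_two, Fin.sum_univ_four,
    conjTranspose_apply, diagonal_apply, Matrix.smul_apply, smul_eq_mul]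
  simp [div_eq_mul_inv]
  ring_nf
  simp only [Complex.I_sq, Complex.I_pow_four]
  ring

theorem two_le_div_add_div {a b : ℝ} (ha : 0 < a) (hb : 0 < b) : 2 ≤ a / b + b / a := by
  rw [div_add_div _ _ hb.ne' ha.ne', le_div_iff₀ (mul_pos hb ha)]
  nlinarith [sq_nonneg (a - b)]

theorem stmt13 (s : Fin 4 → ℝ) (hs : ∀ i, 0 < s i) :
    ((Lmatᴴ * diagonal (fun i => ((s i : ℂ)) ^ 2) * Lmat)
      * (Rmatᴴ * diagonal (fun i => ((((s i) ^ 2)⁻¹ : ℝ) : ℂ)) * Rmat)).trace.im = 0 ∧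
    2 ≤ ((Lmatᴴ * diagonal (fun i => ((s i : ℂ)) ^ 2) * Lmat)
      * (Rmatᴴ * diagonal (fun i => ((((s i) ^ 2)⁻¹ : ℝ) : ℂ)) * Rmat)).trace.re := by
  rw [trace_eq_ofReal_sum_ratios s]
  refine ⟨Complex.ofReal_im _, ?_⟩
  rw [Complex.ofReal_re]
  have h (i j : Fin 4) : 2 ≤ s i ^ 2 / s j ^ 2 + s j ^ 2 / s i ^ 2 :=
    two_le_div_add_div (pow_pos (hs i) 2) (pow_pos (hs j) 2)
  linarith [h 0 1, h 0 2, h 0 3, h 1 2, h 1 3, h 2 3]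
end
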